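/- The orthogonal group O_2(ℝ) of 2 × 2 real orthogonal matrices has exactly three z-classes, consisting respectively of the reflections, the non-central rotations, and the central elements {I, −I}. -/

import Mathlib

/-- Two elements of a group are *z-equivalent* if their centralizers are conjugate:
there is `a` with `a ⬝ Z(g) ⬝ a⁻¹ = Z(h)`. -/
def IsZEquiv {G : Type*} [Group G] (g h : G) : Prop :=
  ∃ a : G, ∀ x : G, x ∈ Subgroup.centralizer {g} ↔ a * x * a⁻¹ ∈ Subgroup.centralizer {h}

namespace IsZEquiv

variable {G : Type*} [Group G] {g h k : G}

theorem symm (H : IsZEquiv g h) : IsZEquiv h g := by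
  obtain ⟨a, ha⟩ := H
  refine ⟨a⁻¹, fun x => ?_⟩
  rw [ha]
  simp [mul_assoc]

theorem trans (H : IsZEquiv g h) (K : IsZEquiv h k) : IsZEquiv g k := by
  obtain ⟨a, ha⟩ := H
  obtain ⟨b, hb⟩ := K
  refine ⟨b * a, fun x => ?_⟩
  rw [ha, hb]
  simp [mul_assoc]

theorem of_conj {a : G} (H : a * g * a⁻¹ = h) : IsZEquiv g h := by
  refine ⟨a, fun x => ?_⟩
  subst H
  rw [Subgroup.mem_centralizer_singleton_iff, Subgroup.mem_centralizer_singleton_iff,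
    conj_mul, conj_mul, mul_left_inj, mul_right_inj]

theorem of_centralizer_eq (H : Subgroup.centralizer {g} = Subgroup.centralizer {h}) :
    IsZEquiv g h :=
  ⟨1, fun x => by simp [H]⟩

/-- The property of being central is invariant under z-equivalence. -/
theorem commute_all (H : IsZEquiv g h) (hg : ∀ x, Commute x g) (x : G) : Commute x h := by
  obtain ⟨a, ha⟩ := H
  have := (ha (a⁻¹ * x * a)).1 (Subgroup.mem_centralizer_singleton_iff.2 (hg _))
  rw [Subgroup.mem_centralizer_singleton_iff] at this
  simpa [mul_assoc, Commute, SemiconjBy] using this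

end IsZEquiv

namespace OrthogonalGroupTwo

local notation "O₂" => Matrix.orthogonalGroup (Fin 2) ℝ

/-- The rotation by the angle `θ`. -/
noncomputable def rot (θ : ℝ) : O₂ :=
  ⟨!![Real.cos θ, -Real.sin θ; Real.sin θ, Real.cos θ], by
    rw [Matrix.mem_orthogonalGroup_iff]
    ext i j
    fin_cases i <;> fin_cases j <;>
      simp [Matrix.mul_apply, Fin.sum_univ_two] <;>
      linarith [Real.sin_sq_add_cos_sq θ]⟩

/-- The reflection in the line through the origin at angle `θ / 2`. -/
noncomputable def refl (θ : ℝ) : O₂ :=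
  ⟨!![Real.cos θ, Real.sin θ; Real.sin θ, -Real.cos θ], by
    rw [Matrix.mem_orthogonalGroup_iff]
    ext i j
    fin_cases i <;> fin_cases j <;>
      simp [Matrix.mul_apply, Fin.sum_univ_two] <;>
      linarith [Real.sin_sq_add_cos_sq θ]⟩

theorem coe_rot (θ : ℝ) : (rot θ : Matrix (Fin 2) (Fin 2) ℝ) =
    !![Real.cos θ, -Real.sin θ; Real.sin θ, Real.cos θ] := rfl

theorem coe_refl (θ : ℝ) : (refl θ : Matrix (Fin 2) (Fin 2) ℝ) =
    !![Real.cos θ, Real.sin θ; Real.sin θ, -Real.cos θ] := rfl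

theorem rot_mul_rot (θ φ : ℝ) : rot θ * rot φ = rot (θ + φ) := by
  ext i j
  fin_cases i <;> fin_cases j <;>
    simp [coe_rot, Matrix.mul_apply, Fin.sum_univ_two, Real.cos_add, Real.sin_add] <;> ring

theorem rot_mul_refl (θ φ : ℝ) : rot θ * refl φ = refl (θ + φ) := by
  ext i j
  fin_cases i <;> fin_cases j <;>
    simp [coe_rot, coe_refl, Matrix.mul_apply, Fin.sum_univ_two, Real.cos_add, Real.sin_add] <;>
    ring

theorem refl_mul_rot (θ φ : ℝ) : refl θ * rot φ = refl (θ - φ) := by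
  ext i j
  fin_cases i <;> fin_cases j <;>
    simp [coe_rot, coe_refl, Matrix.mul_apply, Fin.sum_univ_two, Real.cos_sub, Real.sin_sub] <;>
    ring

theorem det_rot (θ : ℝ) : (rot θ : Matrix (Fin 2) (Fin 2) ℝ).det = 1 := by
  rw [coe_rot, Matrix.det_fin_two_of]
  linarith [Real.sin_sq_add_cos_sq θ]

theorem det_refl (θ : ℝ) : (refl θ : Matrix (Fin 2) (Fin 2) ℝ).det = -1 := by
  rw [coe_refl, Matrix.det_fin_two_of]
  linarith [Real.sin_sq_add_cos_sq θ]

theorem exists_angle {c s : ℝ} (h : c ^ 2 + s ^ 2 = 1) :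
    ∃ θ : ℝ, Real.cos θ = c ∧ Real.sin θ = s := by
  have hn : ‖(⟨c, s⟩ : ℂ)‖ = 1 := by
    rw [Complex.norm_eq_sqrt_sq_add_sq, h, Real.sqrt_one]
  refine ⟨Complex.arg ⟨c, s⟩, ?_, ?_⟩
  · rw [Complex.cos_arg (norm_ne_zero_iff.1 (by simp [hn])), hn, div_one]
  · rw [Complex.sin_arg, hn, div_one]

theorem eq_rot_or_eq_refl (A : O₂) : (∃ θ, A = rot θ) ∨ ∃ θ, A = refl θ := by
  obtain ⟨M, hM⟩ := A
  have hL := (Matrix.mem_orthogonalGroup_iff' (Fin 2) ℝ).1 hM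
  have l00 := congr_fun₂ hL 0 0
  have l01 := congr_fun₂ hL 0 1
  have l11 := congr_fun₂ hL 1 1
  simp [Matrix.mul_apply, Fin.sum_univ_two] at l00 l01 l11
  obtain ⟨θ, hc, hs⟩ := exists_angle (c := M 0 0) (s := M 1 0) (by linarith)
  have key : (M 0 1 = -M 1 0 ∧ M 1 1 = M 0 0) ∨ (M 0 1 = M 1 0 ∧ M 1 1 = -M 0 0) := by
    have e1 : M 0 1 = -(M 0 0 * M 1 1 - M 0 1 * M 1 0) * M 1 0 := by
      linear_combination (-M 0 1) * l00 + M 0 0 * l01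
    have e2 : M 1 1 = (M 0 0 * M 1 1 - M 0 1 * M 1 0) * M 0 0 := by
      linear_combination (-M 1 1) * l00 + M 1 0 * l01
    have e3 : (M 0 0 * M 1 1 - M 0 1 * M 1 0) ^ 2 = 1 := by
      linear_combination (M 0 1 ^ 2 + M 1 1 ^ 2) * l00 -
        (M 0 0 * M 0 1 + M 1 0 * M 1 1) * l01 + l11
    rcases eq_or_eq_neg_of_sq_eq_sq _ 1 (e3.trans (one_pow 2).symm) with h | h
    · left; rw [h] at e1 e2; exact ⟨by linarith, by linarith⟩
    · right; rw [h] at e1 e2; exact ⟨by linarith, by linarith⟩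
  rcases key with ⟨h1, h2⟩ | ⟨h1, h2⟩
  · refine .inl ⟨θ, Subtype.ext ?_⟩
    ext i j
    fin_cases i <;> fin_cases j <;> simp [coe_rot, *]
  · refine .inr ⟨θ, Subtype.ext ?_⟩
    ext i j
    fin_cases i <;> fin_cases j <;> simp [coe_refl, *]

theorem commute_rot_rot (θ φ : ℝ) : Commute (rot θ) (rot φ) := by
  rw [Commute, SemiconjBy, rot_mul_rot, rot_mul_rot, add_comm]

theorem refl_eq_refl_iff {θ φ : ℝ} :
    refl θ = refl φ ↔ Real.cos θ = Real.cos φ ∧ Real.sin θ = Real.sin φ := by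
  constructor
  · intro h
    have h' := congr_arg (Subtype.val : O₂ → _) h
    exact ⟨by simpa [coe_refl] using congr_fun₂ h' 0 0,
      by simpa [coe_refl] using congr_fun₂ h' 0 1⟩
  · rintro ⟨hc, hs⟩
    exact Subtype.ext (by rw [coe_refl, coe_refl, hc, hs])

theorem commute_rot_refl_iff {θ φ : ℝ} : Commute (rot θ) (refl φ) ↔ Real.sin θ = 0 := by
  rw [Commute, SemiconjBy, rot_mul_refl, refl_mul_rot, refl_eq_refl_iff, Real.cos_add,
    Real.cos_sub, Real.sin_add, Real.sin_sub]
  constructor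
  · rintro ⟨h1, h2⟩
    linear_combination (-Real.sin φ / 2) * h1 + (Real.cos φ / 2) * h2 -
      Real.sin θ * Real.sin_sq_add_cos_sq φ
  · intro h
    simp [h, mul_comm]

theorem coe_rot_eq_one_or_neg_one_iff {θ : ℝ} :
    ((rot θ : Matrix (Fin 2) (Fin 2) ℝ) = 1 ∨ (rot θ : Matrix (Fin 2) (Fin 2) ℝ) = -1) ↔
      Real.sin θ = 0 := by
  constructor
  · rintro (h | h) <;> simpa [coe_rot] using congr_fun₂ h 1 0
  · intro h
    refine (Real.sin_eq_zero_iff_cos_eq.1 h).imp (fun hc => ?_) (fun hc => ?_) <;>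
    · rw [coe_rot, h, hc]
      ext i j
      fin_cases i <;> fin_cases j <;> simp

theorem not_coe_refl_eq_one_or_neg_one (θ : ℝ) :
    ¬ ((refl θ : Matrix (Fin 2) (Fin 2) ℝ) = 1 ∨ (refl θ : Matrix (Fin 2) (Fin 2) ℝ) = -1) := by
  rintro (h | h) <;>
  · have := congr_arg Matrix.det h
    norm_num [det_refl, Matrix.det_neg] at this

theorem isZEquiv_refl_refl (θ φ : ℝ) : IsZEquiv (refl θ) (refl φ) := by
  refine IsZEquiv.of_conj (a := rot ((φ - θ) / 2)) ?_
  rw [mul_inv_eq_iff_eq_mul, rot_mul_refl, refl_mul_rot]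
  congr 1
  ring

theorem commute_rot_iff {θ : ℝ} (h : Real.sin θ ≠ 0) (x : O₂) :
    Commute x (rot θ) ↔ (x : Matrix (Fin 2) (Fin 2) ℝ).det = 1 := by
  rcases eq_rot_or_eq_refl x with ⟨φ, rfl⟩ | ⟨φ, rfl⟩
  · simp [commute_rot_rot, det_rot]
  · rw [show Commute (refl φ) (rot θ) ↔ Commute (rot θ) (refl φ) from ⟨.symm, .symm⟩,
      commute_rot_refl_iff, det_refl]
    norm_num [h]

theorem commute_rot_of_sin_eq_zero {θ : ℝ} (h : Real.sin θ = 0) (x : O₂) :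
    Commute x (rot θ) := by
  rcases eq_rot_or_eq_refl x with ⟨φ, rfl⟩ | ⟨φ, rfl⟩
  · exact commute_rot_rot φ θ
  · exact (commute_rot_refl_iff.2 h).symm

theorem isZEquiv_rot_rot_iff {θ φ : ℝ} :
    IsZEquiv (rot θ) (rot φ) ↔ (Real.sin θ = 0 ↔ Real.sin φ = 0) := by
  have central {α β : ℝ} (H : IsZEquiv (rot α) (rot β)) (h : Real.sin α = 0) : Real.sin β = 0 :=
    commute_rot_refl_iff.1 (H.commute_all (commute_rot_of_sin_eq_zero h) (refl 0)).symm
  refine ⟨fun H => ⟨central H, central H.symm⟩, fun H => IsZEquiv.of_centralizer_eq ?_⟩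
  ext x
  simp only [Subgroup.mem_centralizer_singleton_iff]
  change Commute x (rot θ) ↔ Commute x (rot φ)
  by_cases h : Real.sin θ = 0
  · simp only [commute_rot_of_sin_eq_zero h, commute_rot_of_sin_eq_zero (H.1 h)]
  · rw [commute_rot_iff h, commute_rot_iff (H.not.1 h)]

theorem not_isZEquiv_refl_rot (θ φ : ℝ) : ¬ IsZEquiv (refl θ) (rot φ) := by
  intro H
  by_cases h : Real.sin φ = 0
  · have := H.symm.commute_all (commute_rot_of_sin_eq_zero h) (rot (Real.pi / 2))
    simp [commute_rot_refl_iff] at this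
  · obtain ⟨a, ha⟩ := H
    have hc : Commute (a * refl θ * a⁻¹) (rot φ) :=
      Subgroup.mem_centralizer_singleton_iff.1
        ((ha _).1 (Subgroup.mem_centralizer_singleton_iff.2 rfl))
    have hd : (a : Matrix (Fin 2) (Fin 2) ℝ).det * ((a⁻¹ : O₂) : Matrix (Fin 2) (Fin 2) ℝ).det
        = 1 := by
      rw [← Matrix.det_mul, ← Submonoid.coe_mul, mul_inv_cancel, OneMemClass.coe_one,
        Matrix.det_one]
    rw [commute_rot_iff h, Submonoid.coe_mul, Submonoid.coe_mul, Matrix.det_mul, Matrix.det_mul,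
      det_refl] at hc
    linarith

end OrthogonalGroupTwo

open OrthogonalGroupTwo in
/-- The z-equivalence relation on `O₂(ℝ)`, described through determinants and the centre. -/
theorem isZEquiv_orthogonalGroup_two_iff :
    ∀ A B : Matrix.orthogonalGroup (Fin 2) ℝ, IsZEquiv A B ↔
      (((A : Matrix (Fin 2) (Fin 2) ℝ).det = -1 ∧ (B : Matrix (Fin 2) (Fin 2) ℝ).det = -1) ∨
       (((A : Matrix (Fin 2) (Fin 2) ℝ).det = 1 ∧ (A : Matrix (Fin 2) (Fin 2) ℝ) ≠ 1 ∧
            (A : Matrix (Fin 2) (Fin 2) ℝ) ≠ -1) ∧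
        ((B : Matrix (Fin 2) (Fin 2) ℝ).det = 1 ∧ (B : Matrix (Fin 2) (Fin 2) ℝ) ≠ 1 ∧
            (B : Matrix (Fin 2) (Fin 2) ℝ) ≠ -1)) ∨
       (((A : Matrix (Fin 2) (Fin 2) ℝ) = 1 ∨ (A : Matrix (Fin 2) (Fin 2) ℝ) = -1) ∧
        ((B : Matrix (Fin 2) (Fin 2) ℝ) = 1 ∨ (B : Matrix (Fin 2) (Fin 2) ℝ) = -1))) := by
  intro A B
  simp only [ne_eq, ← not_or]
  have one_ne : (1 : ℝ) ≠ -1 := by norm_num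
  rcases eq_rot_or_eq_refl A with ⟨θ, rfl⟩ | ⟨θ, rfl⟩ <;>
    rcases eq_rot_or_eq_refl B with ⟨φ, rfl⟩ | ⟨φ, rfl⟩
  · simp only [isZEquiv_rot_rot_iff, coe_rot_eq_one_or_neg_one_iff, det_rot, one_ne]
    tauto
  · have h : ¬ IsZEquiv (rot θ) (refl φ) := fun H => not_isZEquiv_refl_rot φ θ H.symm
    simp only [h, not_coe_refl_eq_one_or_neg_one, det_rot, det_refl, one_ne, one_ne.symm]
    tauto
  · simp only [not_isZEquiv_refl_rot, not_coe_refl_eq_one_or_neg_one, det_rot, det_refl, one_ne,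
      one_ne.symm]
    tauto
  · simp only [isZEquiv_refl_refl, det_refl, true_and, true_or]

open OrthogonalGroupTwo in
/-- The orthogonal group `O₂(ℝ)` has exactly three z-classes, consisting respectively of
the reflections (determinant `-1`), the non-central rotations (determinant `1`, not `±I`),
and the central elements `{I, -I}`. -/
theorem three_zClasses_O2 :
    {C : Set (Matrix.orthogonalGroup (Fin 2) ℝ) |
      ∃ g : Matrix.orthogonalGroup (Fin 2) ℝ,
        C = {h : Matrix.orthogonalGroup (Fin 2) ℝ | IsZEquiv g h}}.ncard = 3 ∧
    ∀ A B : Matrix.orthogonalGroup (Fin 2) ℝ, IsZEquiv A B ↔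
      (((A : Matrix (Fin 2) (Fin 2) ℝ).det = -1 ∧ (B : Matrix (Fin 2) (Fin 2) ℝ).det = -1) ∨
       (((A : Matrix (Fin 2) (Fin 2) ℝ).det = 1 ∧ (A : Matrix (Fin 2) (Fin 2) ℝ) ≠ 1 ∧
            (A : Matrix (Fin 2) (Fin 2) ℝ) ≠ -1) ∧
        ((B : Matrix (Fin 2) (Fin 2) ℝ).det = 1 ∧ (B : Matrix (Fin 2) (Fin 2) ℝ) ≠ 1 ∧
            (B : Matrix (Fin 2) (Fin 2) ℝ) ≠ -1)) ∨
       (((A : Matrix (Fin 2) (Fin 2) ℝ) = 1 ∨ (A : Matrix (Fin 2) (Fin 2) ℝ) = -1) ∧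
        ((B : Matrix (Fin 2) (Fin 2) ℝ) = 1 ∨ (B : Matrix (Fin 2) (Fin 2) ℝ) = -1))) := by
  refine ⟨?_, isZEquiv_orthogonalGroup_two_iff⟩
  have ne_of {g h : Matrix.orthogonalGroup (Fin 2) ℝ} (H : ¬ IsZEquiv g h) :
      {k | IsZEquiv g k} ≠ {k | IsZEquiv h k} := fun e =>
    H (e.symm ▸ IsZEquiv.of_centralizer_eq rfl : h ∈ {k | IsZEquiv g k})
  have eq_of {g h : Matrix.orthogonalGroup (Fin 2) ℝ} (H : IsZEquiv g h) :
      {k | IsZEquiv g k} = {k | IsZEquiv h k} :=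
    Set.ext fun _ => ⟨H.symm.trans, H.trans⟩
  rw [Set.ncard_eq_three]
  refine ⟨{k | IsZEquiv (refl 0) k}, {k | IsZEquiv (rot (Real.pi / 2)) k},
    {k | IsZEquiv (rot 0) k}, ne_of (not_isZEquiv_refl_rot _ _),
    ne_of (not_isZEquiv_refl_rot _ _), ne_of (by simp [isZEquiv_rot_rot_iff]), ?_⟩
  ext C
  simp only [Set.mem_ofPred_eq, Set.mem_insert_iff, Set.mem_singleton_iff]
  constructor
  · rintro ⟨g, rfl⟩
    rcases eq_rot_or_eq_refl g with ⟨θ, rfl⟩ | ⟨θ, rfl⟩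
    · by_cases h : Real.sin θ = 0
      · exact .inr (.inr (eq_of (isZEquiv_rot_rot_iff.2 (by simp [h]))))
      · exact .inr (.inl (eq_of (isZEquiv_rot_rot_iff.2 (by simp [h]))))
    · exact .inl (eq_of (isZEquiv_refl_refl _ _))
  · rintro (rfl | rfl | rfl) <;> exact ⟨_, rfl⟩
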